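/- For every dimension d ≥ 1 and every m ≥ 2 there is a deterministic, non-adaptive algorithm for L1-approximation on the class F_mon^d which uses the (m−1)^d function values at the interior grid points (i_1/m,…,i_d/m), 1 ≤ i_j ≤ m−1, and whose worst-case L1-error is at most d/m. Consequently, for every n ≥ 1, e^det(n, F_mon^d) ≤ d·n^{−1/d}. -/

import Mathlib

open MeasureTheory
open scoped ENNReal NNReal

noncomputable section

/-- The unit cube `[0,1]^d`. -/
def unitCube (d : ℕ) : Set (Fin d → ℝ) := Set.Icc 0 1

/-- The class of monotone functions `f : [0,1]^d → [-1,1]`. -/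
def FMon (d : ℕ) : Set ((Fin d → ℝ) → ℝ) :=
  {f | (∀ x ∈ unitCube d, f x ∈ Set.Icc (-1 : ℝ) 1) ∧
       (∀ x ∈ unitCube d, ∀ y ∈ unitCube d, x ≤ y → f x ≤ f y)}

/-- The (extended-real-valued) `L₁([0,1]^d)` distance between two functions. -/
def dist1e {d : ℕ} (g f : (Fin d → ℝ) → ℝ) : ℝ≥0∞ :=
  ∫⁻ x in unitCube d, ENNReal.ofReal |g x - f x|

/-- A deterministic (adaptive) algorithm using `n` function values: the `i`-th node may
depend on the previously computed `i` function values, and the output is built from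
all `n` computed values. -/
structure DetAlgo (d n : ℕ) where
  node : (i : Fin n) → (Fin i → ℝ) → (Fin d → ℝ)
  output : (Fin n → ℝ) → (Fin d → ℝ) → ℝ

/-- The adaptively computed information `y_i = f(x_i)`. -/
def DetAlgo.infoAux {d n : ℕ} (A : DetAlgo d n) (f : (Fin d → ℝ) → ℝ) :
    (i : ℕ) → i < n → ℝ
  | i, h => f (A.node ⟨i, h⟩ (fun j => A.infoAux f j.1 (j.2.trans h)))
termination_by i h => i
decreasing_by exact j.2

/-- The output `φ(N(f))` of a deterministic algorithm applied to an input `f`. -/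
def DetAlgo.apply {d n : ℕ} (A : DetAlgo d n) (f : (Fin d → ℝ) → ℝ) :
    (Fin d → ℝ) → ℝ :=
  A.output (fun i => A.infoAux f i.1 i.2)

/-- Worst-case error of a deterministic algorithm on the class `FMon d`. -/
def detError {d n : ℕ} (A : DetAlgo d n) : ℝ≥0∞ :=
  ⨆ f : FMon d, dist1e (A.apply f.1) f.1

/-- A Monte Carlo algorithm: a family of deterministic algorithms indexed by a
probability space. -/
structure MCAlgo (d n : ℕ) where
  Ω : Type
  m : MeasurableSpace Ω
  P : @Measure Ω m
  prob : @IsProbabilityMeasure Ω m P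
  algo : Ω → DetAlgo d n

/-- Worst-case expected error of a Monte Carlo algorithm on the class `FMon d`. -/
def mcError {d n : ℕ} (A : MCAlgo d n) : ℝ≥0∞ :=
  ⨆ f : FMon d, @lintegral A.Ω A.m A.P (fun ω => dist1e ((A.algo ω).apply f.1) f.1)

/-- Deterministic `ε`-complexity: minimal number of function values needed by a
deterministic algorithm to achieve worst-case error `≤ ε`. -/
def nDet (d : ℕ) (ε : ℝ) : ℕ :=
  sInf {n | ∃ A : DetAlgo d n, detError A ≤ ENNReal.ofReal ε}

/-- Monte Carlo `ε`-complexity: minimal number of function values needed by a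
Monte Carlo algorithm to achieve worst-case expected error `≤ ε`. -/
def nRan (d : ℕ) (ε : ℝ) : ℕ :=
  sInf {n | ∃ A : MCAlgo d n, mcError A ≤ ENNReal.ofReal ε}

/-- The grid point `v / m`. -/
def gridPoint {d : ℕ} (m : ℕ) (v : Fin d → ℕ) : Fin d → ℝ := fun j => (v j : ℝ) / m

open Classical in
/-- The extension of a function on the interior grid by `-1` to the indices with some coordinate
`0`, and by `1` to the remaining indices with some coordinate at least `m`. -/
def gridExtend {d : ℕ} (m : ℕ) (g : (Fin d → ℕ) → ℝ) (v : Fin d → ℕ) : ℝ :=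
  if ∃ j, v j = 0 then -1 else if ∃ j, m ≤ v j then 1 else g v

/-- The index of the half-open subcube of side `1 / m` containing `x`. -/
def cellIndex {d : ℕ} (m : ℕ) (x : Fin d → ℝ) : Fin d → ℕ := fun j => ⌊m * x j⌋₊

/-- The half-open subcube of side `1 / m` with lower corner `v / m`. -/
def gridCell {d : ℕ} (m : ℕ) (v : Fin d → ℕ) : Set (Fin d → ℝ) :=
  Set.univ.pi fun j => Set.Ico ((v j : ℝ) / m) (((v j + 1 : ℕ) : ℝ) / m)

/-- The average of the extended values at the two extreme corners of the subcube of `x`. -/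
def midpointApprox {d : ℕ} (m : ℕ) (g : (Fin d → ℕ) → ℝ) (x : Fin d → ℝ) : ℝ :=
  (gridExtend m g (cellIndex m x) + gridExtend m g (cellIndex m x + 1)) / 2

open Classical in
/-- The grid algorithm evaluating at the grid points with indices `p i`. -/
def gridAlgo {d n : ℕ} (m : ℕ) (p : Fin n → Fin d → ℕ) : DetAlgo d n where
  node i _ := gridPoint m (p i)
  output y := midpointApprox m fun v => if h : ∃ i, p i = v then y h.choose else 0

section

variable {d m : ℕ}

lemma gridExtend_congr {g g' : (Fin d → ℕ) → ℝ}
    (h : ∀ v : Fin d → ℕ, (∀ j, 1 ≤ v j ∧ v j ≤ m - 1) → g v = g' v) (v : Fin d → ℕ) :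
    gridExtend m g v = gridExtend m g' v := by
  unfold gridExtend
  split_ifs with h0 h1
  · rfl
  · rfl
  · push Not at h0 h1
    refine h v fun j => ?_
    have := h0 j
    have := h1 j
    omega

lemma gridAlgo_apply {n : ℕ} {p : Fin n → Fin d → ℕ}
    (hp : ∀ v : Fin d → ℕ, (∀ j, 1 ≤ v j ∧ v j ≤ m - 1) → ∃ i, p i = v)
    (f : (Fin d → ℝ) → ℝ) :
    (gridAlgo m p).apply f = midpointApprox m fun v => f (gridPoint m v) := by
  have hinfo (i : Fin n) : (gridAlgo m p).infoAux f i.1 i.2 = f (gridPoint m (p i)) := by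
    rw [DetAlgo.infoAux]
    rfl
  have hcongr := gridExtend_congr (m := m)
    (g := fun v => if h : ∃ i, p i = v then f (gridPoint m (p h.choose)) else 0)
    (g' := fun v => f (gridPoint m v)) fun v hv => by
      have h := hp v hv
      simp only [dif_pos h, h.choose_spec]
  funext x
  simp only [DetAlgo.apply, hinfo]
  simp only [gridAlgo, midpointApprox]
  rw [← hcongr, ← hcongr]

lemma cellIndex_eq (hm : 0 < m) {v : Fin d → ℕ} {x : Fin d → ℝ} (hx : x ∈ gridCell m v) :
    cellIndex m x = v := by
  have hm' : (0 : ℝ) < m := by exact_mod_cast hm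
  funext j
  obtain ⟨h1, h2⟩ := hx j (Set.mem_univ j)
  rw [div_le_iff₀ hm'] at h1
  rw [lt_div_iff₀ hm'] at h2
  push_cast at h2
  have : (0 : ℝ) ≤ v j := by positivity
  exact (Nat.floor_eq_iff (by linarith)).2 ⟨by linarith, by linarith⟩

lemma mem_gridCell_cellIndex (hm : 0 < m) {x : Fin d → ℝ} (hx : ∀ j, 0 ≤ x j) :
    x ∈ gridCell m (cellIndex m x) := by
  have hm' : (0 : ℝ) < m := by exact_mod_cast hm
  intro j _
  constructor
  · rw [div_le_iff₀ hm', mul_comm]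
    exact Nat.floor_le (mul_nonneg hm'.le (hx j))
  · rw [lt_div_iff₀ hm', mul_comm]
    push_cast
    exact Nat.lt_floor_add_one _

lemma gridPoint_mem_unitCube {v : Fin d → ℕ} (hv : ∀ j, v j ≤ m) :
    gridPoint m v ∈ unitCube d :=
  ⟨fun _ => div_nonneg (Nat.cast_nonneg _) (Nat.cast_nonneg _),
    fun j => div_le_one_of_le₀ (Nat.cast_le.2 (hv j)) (Nat.cast_nonneg _)⟩

lemma gridExtend_le_and_le {f : (Fin d → ℝ) → ℝ} (hf : f ∈ FMon d)
    {v : Fin d → ℕ} (hv : ∀ j, v j < m) {x : Fin d → ℝ} (hx : x ∈ gridCell m v) :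
    gridExtend m (fun v => f (gridPoint m v)) v ≤ f x ∧
      f x ≤ gridExtend m (fun v => f (gridPoint m v)) (v + 1) := by
  have hlow : gridPoint m v ≤ x := fun j => (hx j (Set.mem_univ j)).1
  have hupp : x ≤ gridPoint m (v + 1) := fun j => (hx j (Set.mem_univ j)).2.le
  have hv0 := gridPoint_mem_unitCube fun j => (hv j).le
  have hv1 := gridPoint_mem_unitCube (v := v + 1) fun j => hv j
  have hxu : x ∈ unitCube d := ⟨hv0.1.trans hlow, hupp.trans hv1.2⟩
  constructor
  · unfold gridExtend
    split_ifs with h0 h1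
    · exact (hf.1 x hxu).1
    · obtain ⟨j, hj⟩ := h1
      exact absurd (hv j) (not_lt.2 hj)
    · exact hf.2 _ hv0 _ hxu hlow
  · have h0 : ¬ ∃ j, (v + 1) j = 0 := fun ⟨j, hj⟩ => Nat.succ_ne_zero _ hj
    rw [gridExtend, if_neg h0]
    split_ifs
    · exact (hf.1 x hxu).2
    · exact hf.2 _ hxu _ hv1 hupp

lemma gridPoint_mem_gridCell (hm : 0 < m) (v : Fin d → ℕ) : gridPoint m v ∈ gridCell m v := by
  have hm' : (0 : ℝ) < m := by exact_mod_cast hm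
  refine fun j _ => ⟨le_rfl, ?_⟩
  exact div_lt_div_of_pos_right (by push_cast; linarith) hm'

lemma measurableSet_gridCell (m : ℕ) (v : Fin d → ℕ) : MeasurableSet (gridCell m v) :=
  MeasurableSet.univ_pi fun _ => measurableSet_Ico

lemma volume_gridCell (m : ℕ) (v : Fin d → ℕ) :
    volume (gridCell m v) = ENNReal.ofReal ((1 / (m : ℝ)) ^ d) := by
  rw [gridCell, Real.volume_pi_Ico, ENNReal.ofReal_pow (by positivity)]
  have h (j : Fin d) : (((v j + 1 : ℕ) : ℝ) / m - (v j : ℝ) / m) = 1 / m := by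
    push_cast
    ring
  simp only [h, Finset.prod_const, Finset.card_univ, Fintype.card_fin]

/-- Telescoping along diagonals of the grid. -/
lemma sum_gridExtend_diff (g : (Fin d → ℕ) → ℝ) (hm : 0 < m) :
    ∑ v ∈ Fintype.piFinset fun _ : Fin d => Finset.range m,
      (gridExtend m g (v + 1) - gridExtend m g v) =
        2 * ((m : ℝ) ^ d - ((m : ℝ) - 1) ^ d) := by
  set S := Fintype.piFinset fun _ : Fin d => Finset.range m with hS
  set T := Fintype.piFinset fun _ : Fin d => Finset.Ico 1 (m + 1) with hT
  set C := Fintype.piFinset fun _ : Fin d => Finset.Ico 1 m with hC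
  have hCS : C ⊆ S := Fintype.piFinset_subset _ _ fun _ a ha => by
    simp only [Finset.mem_Ico, Finset.mem_range] at ha ⊢
    omega
  have hCT : C ⊆ T := Fintype.piFinset_subset _ _ fun _ a ha => by
    simp only [Finset.mem_Ico] at ha ⊢
    omega
  have hcardS : (S.card : ℝ) = (m : ℝ) ^ d := by
    simp [hS]
  have hcardT : (T.card : ℝ) = (m : ℝ) ^ d := by
    simp [hT]
  have hcardC : (C.card : ℝ) = ((m : ℝ) - 1) ^ d := by
    simp [hC, Nat.cast_sub hm]
  have hshift : ∑ v ∈ S, gridExtend m g (v + 1) = ∑ v ∈ T, gridExtend m g v := by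
    refine Finset.sum_bij' (fun v _ => v + 1) (fun v _ => v - 1) ?_ ?_ ?_ ?_ ?_
    · intro v hv
      simp only [hS, hT, Fintype.mem_piFinset, Finset.mem_range, Finset.mem_Ico] at hv ⊢
      intro j
      have := hv j
      simp only [Pi.add_apply, Pi.one_apply]
      omega
    · intro v hv
      simp only [hS, hT, Fintype.mem_piFinset, Finset.mem_range, Finset.mem_Ico] at hv ⊢
      intro j
      have := hv j
      simp only [Pi.sub_apply, Pi.one_apply]
      omega
    · intro v _
      funext j
      simp
    · intro v hv
      simp only [hT, Fintype.mem_piFinset, Finset.mem_Ico] at hv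
      funext j
      exact Nat.sub_add_cancel (hv j).1
    · intro v _
      rfl
  have hlow : ∑ v ∈ S \ C, gridExtend m g v = -((S \ C).card : ℝ) := by
    rw [Finset.sum_congr rfl (g := fun _ => (-1 : ℝ)), Finset.sum_const, nsmul_eq_mul, mul_neg_one]
    intro v hv
    simp only [hS, hC, Finset.mem_sdiff, Fintype.mem_piFinset, Finset.mem_range, Finset.mem_Ico,
      not_forall] at hv
    obtain ⟨hv, j, hj⟩ := hv
    have := hv j
    exact if_pos ⟨j, by omega⟩
  have hupp : ∑ v ∈ T \ C, gridExtend m g v = ((T \ C).card : ℝ) := by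
    rw [Finset.sum_congr rfl (g := fun _ => (1 : ℝ)), Finset.sum_const, nsmul_eq_mul, mul_one]
    intro v hv
    simp only [hT, hC, Finset.mem_sdiff, Fintype.mem_piFinset, Finset.mem_Ico,
      not_forall] at hv
    obtain ⟨hv, j, hj⟩ := hv
    have := hv j
    have h0 : ¬ ∃ j, v j = 0 := by
      rintro ⟨k, hk⟩
      have := hv k
      omega
    rw [gridExtend, if_neg h0, if_pos ⟨j, by omega⟩]
  rw [Finset.sum_sub_distrib, hshift, ← Finset.sum_sdiff hCT, ← Finset.sum_sdiff hCS, hlow, hupp,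
    Finset.cast_card_sdiff hCT, Finset.cast_card_sdiff hCS, hcardS, hcardT, hcardC]
  ring

lemma dist1e_midpointApprox_le (hm : 0 < m) {f : (Fin d → ℝ) → ℝ} (hf : f ∈ FMon d) :
    dist1e (midpointApprox m fun v => f (gridPoint m v)) f ≤ ENNReal.ofReal ((d : ℝ) / m) := by
  have hm' : (0 : ℝ) < m := by exact_mod_cast hm
  set G := gridExtend m fun v : Fin d → ℕ => f (gridPoint m v) with hG
  set S := Fintype.piFinset fun _ : Fin d => Finset.range m with hS
  have hSm (v : Fin d → ℕ) (hv : v ∈ S) (j : Fin d) : v j < m := by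
    simpa using Fintype.mem_piFinset.1 hv j
  have hmono (v : Fin d → ℕ) (hv : v ∈ S) : 0 ≤ G (v + 1) - G v := by
    have := gridExtend_le_and_le hf (hSm v hv) (gridPoint_mem_gridCell hm v)
    linarith
  have hcell (v : Fin d → ℕ) (hv : v ∈ S) :
      ∫⁻ x in gridCell m v,
          ENNReal.ofReal |midpointApprox m (fun v => f (gridPoint m v)) x - f x| ≤
        ENNReal.ofReal ((G (v + 1) - G v) / 2 * (1 / (m : ℝ)) ^ d) := by
    refine (setLIntegral_mono' (g := fun _ => ENNReal.ofReal ((G (v + 1) - G v) / 2))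
      (measurableSet_gridCell m v) fun x hx => ?_).trans ?_
    · refine ENNReal.ofReal_le_ofReal ?_
      have := gridExtend_le_and_le hf (hSm v hv) hx
      rw [midpointApprox, cellIndex_eq hm hx, ← hG, abs_le]
      constructor <;> linarith
    · rw [setLIntegral_const, volume_gridCell,
        ENNReal.ofReal_mul (div_nonneg (hmono v hv) zero_le_two)]
  have hcover : (Set.univ.pi fun _ : Fin d => Set.Ico (0 : ℝ) 1) ⊆
      ⋃ v : S, gridCell m (v : Fin d → ℕ) := by
    intro x hx
    refine Set.mem_iUnion.2 ⟨⟨cellIndex m x, Fintype.mem_piFinset.2 fun j => ?_⟩,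
      mem_gridCell_cellIndex hm fun j => (hx j (Set.mem_univ j)).1⟩
    obtain ⟨h0, h1⟩ := hx j (Set.mem_univ j)
    rw [Finset.mem_range, cellIndex, Nat.floor_lt (mul_nonneg hm'.le h0)]
    exact mul_lt_of_lt_one_right hm' h1
  have hcube : (Set.univ.pi fun _ : Fin d => Set.Ico (0 : ℝ) 1) =ᵐ[volume] unitCube d :=
    Measure.univ_pi_Ico_ae_eq_Icc
  have hbern : 1 - (d : ℝ) / m ≤ (1 - 1 / (m : ℝ)) ^ d := by
    have h1 : 1 / (m : ℝ) ≤ 1 := by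
      rw [div_le_one hm']
      exact_mod_cast hm
    have := one_add_mul_le_pow (a := -(1 / (m : ℝ))) (by linarith) d
    rwa [mul_neg, mul_one_div, ← sub_eq_add_neg, ← sub_eq_add_neg] at this
  have hpow : (m : ℝ) ^ d * (1 / (m : ℝ)) ^ d = 1 := by
    rw [← mul_pow, mul_one_div_cancel hm'.ne', one_pow]
  have hpow' : ((m : ℝ) - 1) ^ d * (1 / (m : ℝ)) ^ d = (1 - 1 / (m : ℝ)) ^ d := by
    rw [← mul_pow, sub_mul, mul_one_div_cancel hm'.ne', one_mul]
  calc dist1e (midpointApprox m fun v => f (gridPoint m v)) f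
      = ∫⁻ x in Set.univ.pi fun _ : Fin d => Set.Ico (0 : ℝ) 1,
          ENNReal.ofReal |midpointApprox m (fun v => f (gridPoint m v)) x - f x| :=
        (setLIntegral_congr hcube).symm
    _ ≤ ∫⁻ x in ⋃ v : S, gridCell m (v : Fin d → ℕ),
          ENNReal.ofReal |midpointApprox m (fun v => f (gridPoint m v)) x - f x| :=
        lintegral_mono_set hcover
    _ ≤ ∑ v : S, ∫⁻ x in gridCell m (v : Fin d → ℕ),
          ENNReal.ofReal |midpointApprox m (fun v => f (gridPoint m v)) x - f x| :=
        (lintegral_iUnion_le _ _).trans_eq (tsum_fintype _)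
    _ ≤ ∑ v : S, ENNReal.ofReal ((G ((v : Fin d → ℕ) + 1) - G v) / 2 * (1 / (m : ℝ)) ^ d) :=
        Finset.sum_le_sum fun v _ => hcell v v.2
    _ = ENNReal.ofReal (∑ v ∈ S, (G (v + 1) - G v) / 2 * (1 / (m : ℝ)) ^ d) := by
        rw [ENNReal.ofReal_sum_of_nonneg fun v hv => mul_nonneg
          (div_nonneg (hmono v hv) zero_le_two) (by positivity)]
        exact Finset.sum_coe_sort S fun v =>
          ENNReal.ofReal ((G (v + 1) - G v) / 2 * (1 / (m : ℝ)) ^ d)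
    _ ≤ ENNReal.ofReal ((d : ℝ) / m) := by
        refine ENNReal.ofReal_le_ofReal ?_
        rw [← Finset.sum_mul, ← Finset.sum_div, sum_gridExtend_diff _ hm,
          mul_div_cancel_left₀ _ two_ne_zero, sub_mul, hpow, hpow']
        linarith

lemma detError_gridAlgo_le {n : ℕ} (hm : 0 < m) {p : Fin n → Fin d → ℕ}
    (hp : ∀ v : Fin d → ℕ, (∀ j, 1 ≤ v j ∧ v j ≤ m - 1) → ∃ i, p i = v) :
    detError (gridAlgo m p) ≤ ENNReal.ofReal ((d : ℝ) / m) := by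
  refine iSup_le fun f => ?_
  rw [gridAlgo_apply hp]
  exact dist1e_midpointApprox_le hm f.2

/-- An enumeration of the indices of the interior grid points. -/
def interiorIndex (d m : ℕ) (i : Fin ((m - 1) ^ d)) : Fin d → ℕ :=
  fun j => finFunctionFinEquiv.symm i j + 1

lemma interiorIndex_mem (i : Fin ((m - 1) ^ d)) (j : Fin d) :
    1 ≤ interiorIndex d m i j ∧ interiorIndex d m i j ≤ m - 1 :=
  ⟨Nat.succ_pos _, (finFunctionFinEquiv.symm i j).2⟩

lemma exists_interiorIndex_eq (v : Fin d → ℕ) (hv : ∀ j, 1 ≤ v j ∧ v j ≤ m - 1) :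
    ∃ i, interiorIndex d m i = v := by
  refine ⟨finFunctionFinEquiv fun j => ⟨v j - 1, by have := hv j; omega⟩, ?_⟩
  funext j
  simpa [interiorIndex] using Nat.sub_add_cancel (hv j).1

lemma exists_detAlgo_detError_le {n : ℕ} (hm : 0 < m) (hn : (m - 1) ^ d ≤ n) :
    ∃ A : DetAlgo d n, detError A ≤ ENNReal.ofReal ((d : ℝ) / m) := by
  refine ⟨gridAlgo m fun i => if h : i.1 < (m - 1) ^ d then interiorIndex d m ⟨i, h⟩ else 0,
    detError_gridAlgo_le hm fun v hv => ?_⟩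
  obtain ⟨i, hi⟩ := exists_interiorIndex_eq v hv
  exact ⟨Fin.castLE hn i, by simpa using hi⟩

end

/-- For `d ≥ 1`, `m ≥ 2` there is a deterministic non-adaptive algorithm
using the `(m-1)^d` function values at the interior grid points `(i₁/m, …, i_d/m)`,
`1 ≤ i_j ≤ m-1`, with worst-case `L₁`-error at most `d/m`; consequently, for every `n ≥ 1`,
`e^det(n, F_mon^d) ≤ d · n^(-1/d)`. -/
theorem statement0 (d m : ℕ) (hd : 1 ≤ d) (hm : 2 ≤ m) :
    (∃ A : DetAlgo d ((m - 1) ^ d),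
      (∀ i, ∃ v : Fin d → ℕ, (∀ j, 1 ≤ v j ∧ v j ≤ m - 1) ∧
          ∀ y, A.node i y = fun j => (v j : ℝ) / m) ∧
      (∀ v : Fin d → ℕ, (∀ j, 1 ≤ v j ∧ v j ≤ m - 1) →
          ∃ i, ∀ y, A.node i y = fun j => (v j : ℝ) / m) ∧
      detError A ≤ ENNReal.ofReal ((d : ℝ) / m)) ∧
    (∀ n : ℕ, 1 ≤ n →
      ∃ A : DetAlgo d n,
        detError A ≤ ENNReal.ofReal ((d : ℝ) * (n : ℝ) ^ (-(1 : ℝ) / d))) := by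
  refine ⟨⟨gridAlgo m (interiorIndex d m), fun i => ⟨interiorIndex d m i, interiorIndex_mem i,
    fun _ => rfl⟩, fun v hv => ?_, detError_gridAlgo_le (by omega) exists_interiorIndex_eq⟩,
    fun n hn => ?_⟩
  · obtain ⟨i, rfl⟩ := exists_interiorIndex_eq v hv
    exact ⟨i, fun _ => rfl⟩
  · have hd' : (d : ℝ) ≠ 0 := by exact_mod_cast (by omega : d ≠ 0)
    have hn' : (0 : ℝ) < n := by exact_mod_cast hn
    set r : ℝ := (n : ℝ) ^ (1 / (d : ℝ)) with hr
    have hr0 : 0 < r := Real.rpow_pos_of_pos hn' _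
    have hrd : r ^ d = n := by
      rw [hr, one_div, Real.rpow_inv_natCast_pow hn'.le (by omega)]
    have hle : (⌊r⌋₊ + 1 - 1) ^ d ≤ n := by
      rw [Nat.add_sub_cancel]
      have := pow_le_pow_left₀ (Nat.cast_nonneg _) (Nat.floor_le hr0.le) d
      rw [hrd] at this
      exact_mod_cast this
    obtain ⟨A, hA⟩ := exists_detAlgo_detError_le (Nat.succ_pos ⌊r⌋₊) hle
    refine ⟨A, hA.trans (ENNReal.ofReal_le_ofReal ?_)⟩
    rw [neg_div, Real.rpow_neg hn'.le, ← hr, ← div_eq_mul_inv]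
    have hlt := Nat.lt_floor_add_one r
    push_cast
    exact div_le_div_of_nonneg_left (Nat.cast_nonneg _) hr0 hlt.le

end
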